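/- Let k ≥ 2 be an integer and δ > 0, and let P, P̂ : (0,δ) → (0,δ) be maps with P(s) < s and P̂(s) < s whose orbits decrease to 0. Assume the following asymptotics as s → 0⁺, corresponding to a saddle loop of codimension k: if k is even, s − P(s) ∼ C s^{k/2} and s − P̂(s) ∼ Ĉ s^{k−1}; if k is odd, s − P(s) ∼ C s^{(k+1)/2}(−log s) and s − P̂(s) ∼ Ĉ s^{k}(−log s); where C, Ĉ > 0 (and Ĉ ∈ (0,1) in the case k = 2, where the leading exponent of s − P̂ is 1). Then every orbit {P^{∘n}(s₀)}_{n≥0} has box dimension 1 − 2/k if k is even and 1 − 2/(k+1) if k is odd, while every orbit {P̂^{∘n}(s₀)}_{n≥0} has box dimension 1 − 1/(k−1) if k is even and 1 − 1/k if k is odd. (Here P models the Poincaré map on a transversal away from the saddle vertex and P̂ the Poincaré map on a transversal through the vertex.) -/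

import Mathlib

open Filter MeasureTheory Metric Set Real

/-- Lower box dimension of `U ⊆ X`, with ambient dimension `N`, defined through the
Lebesgue measure of `ε`-neighborhoods:
`inf {d ≥ 0 : liminf_{ε→0⁺} |U_ε| / ε^{N−d} = 0}`. -/
noncomputable def lowerBoxDim {X : Type*} [PseudoEMetricSpace X] [MeasureSpace X]
    (N : ℝ) (U : Set X) : ℝ :=
  sInf {d : ℝ | 0 ≤ d ∧
    Filter.liminf
      (fun ε : ℝ => volume (Metric.thickening ε U) / ENNReal.ofReal (ε ^ (N - d)))
      (nhdsWithin 0 (Set.Ioi 0)) = 0}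

/-- Upper box dimension, defined with `limsup` instead of `liminf`. -/
noncomputable def upperBoxDim {X : Type*} [PseudoEMetricSpace X] [MeasureSpace X]
    (N : ℝ) (U : Set X) : ℝ :=
  sInf {d : ℝ | 0 ≤ d ∧
    Filter.limsup
      (fun ε : ℝ => volume (Metric.thickening ε U) / ENNReal.ofReal (ε ^ (N - d)))
      (nhdsWithin 0 (Set.Ioi 0)) = 0}

/-- The set `U ⊆ X` has box dimension `d`. -/
def HasBoxDim {X : Type*} [PseudoEMetricSpace X] [MeasureSpace X]
    (N : ℝ) (U : Set X) (d : ℝ) : Prop :=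
  lowerBoxDim N U = d ∧ upperBoxDim N U = d

/-- A positive sequence with `s (n+1) ≤ s n - s n ^ (p + 1)` decays at least like
`n ^ (-1/p)`, expressed through `s n ^ (-p)`. -/
lemma eventually_linear_le_rpow_neg {s : ℕ → ℝ} {p : ℝ} (hp : 0 < p) (hpos : ∀ n, 0 < s n)
    (hstep : ∀ᶠ n in atTop, s n ^ (p + 1) ≤ s n - s (n + 1)) :
    ∀ᶠ n : ℕ in atTop, p / 2 * n ≤ s n ^ (-p) := by
  obtain ⟨M, hM⟩ := eventually_atTop.1 hstep
  have hinc : ∀ n ≥ M, s n ^ (-p) + p ≤ s (n + 1) ^ (-p) := by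
    intro n hn
    have hs := hpos n
    have hpow : s n ^ (p + 1) = s n ^ p * s n := by
      rw [Real.rpow_add hs, Real.rpow_one]
    have hle : s (n + 1) ≤ s n * Real.exp (-(s n ^ p)) := by
      have h1 := hM n hn
      have h2 := Real.add_one_le_exp (-(s n ^ p))
      nlinarith
    have hinv : s n ^ (-p) * s n ^ p = 1 := by
      rw [← Real.rpow_add hs]; simp
    calc s n ^ (-p) + p = s n ^ (-p) * (p * s n ^ p + 1) := by
          linear_combination (-p) * hinv
      _ ≤ s n ^ (-p) * Real.exp (p * s n ^ p) := by
          gcongr; exact Real.add_one_le_exp _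
      _ = (s n * Real.exp (-(s n ^ p))) ^ (-p) := by
          rw [Real.mul_rpow hs.le (Real.exp_pos _).le, ← Real.exp_mul]
          congr 2; ring
      _ ≤ s (n + 1) ^ (-p) :=
          Real.rpow_le_rpow_of_nonpos (hpos _) hle (by linarith)
  have hlin : ∀ j : ℕ, p * j ≤ s (M + j) ^ (-p) := by
    intro j
    induction j with
    | zero => simpa using (Real.rpow_pos_of_pos (hpos M) _).le
    | succ j ih =>
      have := hinc (M + j) (by omega)
      push_cast
      rw [← add_assoc]
      linarith
  filter_upwards [eventually_ge_atTop (2 * M)] with n hn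
  obtain ⟨j, rfl⟩ : ∃ j, n = M + j := ⟨n - M, by omega⟩
  have hj : (M : ℝ) ≤ j := by exact_mod_cast (by omega : M ≤ j)
  refine le_trans ?_ (hlin j)
  push_cast
  nlinarith

/-- The `ε`-neighborhood of a nonnegative decreasing sequence is covered by `n` intervals around
the first `n` terms and one interval containing the tail. -/
lemma volume_thickening_range_le {s : ℕ → ℝ} (hpos : ∀ n, 0 < s n) (hanti : Antitone s)
    {ε : ℝ} (hε : 0 < ε) (n : ℕ) :
    volume (thickening ε (range s)) ≤ ENNReal.ofReal (2 * ε * n + (s n + 2 * ε)) := by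
  have hsub : thickening ε (range s) ⊆
      (⋃ i ∈ Finset.range n, ball (s i) ε) ∪ Ioo (-ε) (s n + ε) := by
    intro x hx
    obtain ⟨_, ⟨i, rfl⟩, hi⟩ := mem_thickening_iff.1 hx
    by_cases h : i < n
    · left
      simp only [mem_iUnion]
      exact ⟨i, Finset.mem_range.2 h, hi⟩
    · right
      have h1 := hanti (not_lt.1 h)
      have h2 := hpos i
      rw [Real.dist_eq, abs_lt] at hi
      constructor <;> linarith
  calc volume (thickening ε (range s))
      ≤ volume (⋃ i ∈ Finset.range n, ball (s i) ε) + volume (Ioo (-ε) (s n + ε)) :=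
        (measure_mono hsub).trans (measure_union_le _ _)
    _ ≤ (∑ i ∈ Finset.range n, volume (ball (s i) ε)) + volume (Ioo (-ε) (s n + ε)) := by
        gcongr; exact measure_biUnion_finset_le _ _
    _ = ENNReal.ofReal (2 * ε * n + (s n + 2 * ε)) := by
        simp only [Real.volume_ball, Real.volume_Ioo, Finset.sum_const, Finset.card_range]
        have := hpos n
        rw [nsmul_eq_mul, ENNReal.ofReal_add (by positivity) (by positivity),
          mul_comm (2 * ε), ENNReal.ofReal_mul n.cast_nonneg, ENNReal.ofReal_natCast]
        congr 2; ring

lemma exists_volume_thickening_le {s : ℕ → ℝ} {b : ℝ} (hb : 1 < b) (hpos : ∀ n, 0 < s n)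
    (hanti : Antitone s) (hstep : ∀ᶠ n in atTop, s n ^ b ≤ s n - s (n + 1)) :
    ∃ K : ℝ, ∀ᶠ ε in nhdsWithin 0 (Ioi 0),
      volume (thickening ε (range s)) ≤ ENNReal.ofReal (K * ε ^ (1 / b)) := by
  obtain ⟨p, hp, rfl⟩ : ∃ p, 0 < p ∧ b = p + 1 := ⟨b - 1, by linarith, by ring⟩
  have hdecay := eventually_linear_le_rpow_neg hp hpos hstep
  refine ⟨(p / 2) ^ (-(1 / p)) + 6, ?_⟩
  have hceil : Tendsto (fun ε : ℝ => ⌈ε ^ (-(p / (p + 1)))⌉₊) (nhdsWithin 0 (Ioi 0)) atTop :=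
    tendsto_nat_ceil_atTop.comp
      (tendsto_rpow_neg_nhdsGT_zero (by have : 0 < p / (p + 1) := by positivity
                                        linarith))
  filter_upwards [hceil.eventually hdecay, self_mem_nhdsWithin,
    Ioo_mem_nhdsGT (zero_lt_one' ℝ)] with ε hdec hε hε1
  have hε : 0 < ε := hε
  set n := ⌈ε ^ (-(p / (p + 1)))⌉₊
  refine (volume_thickening_range_le hpos hanti hε n).trans (ENNReal.ofReal_le_ofReal ?_)
  have hpε : 0 < ε ^ (-(p / (p + 1))) := Real.rpow_pos_of_pos hε _
  have hnle : (n : ℝ) ≤ ε ^ (-(p / (p + 1))) + 1 := (Nat.ceil_lt_add_one hpε.le).le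
  have hnge : ε ^ (-(p / (p + 1))) ≤ n := Nat.le_ceil _
  have hmul : ε * ε ^ (-(p / (p + 1))) = ε ^ (1 / (p + 1)) := by
    nth_rewrite 1 [← Real.rpow_one ε]
    rw [← Real.rpow_add hε]
    congr 1; field_simp; ring
  have hεle : ε ≤ ε ^ (1 / (p + 1)) := by
    nth_rewrite 1 [← Real.rpow_one ε]
    apply Real.rpow_le_rpow_of_exponent_ge hε hε1.2.le
    rw [div_le_one (by positivity)]; linarith
  have hsn : s n ≤ (p / 2) ^ (-(1 / p)) * ε ^ (1 / (p + 1)) := by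
    have h1 : p / 2 * ε ^ (-(p / (p + 1))) ≤ s n ^ (-p) :=
      (mul_le_mul_of_nonneg_left hnge (by positivity)).trans hdec
    have h2 := Real.rpow_le_rpow_of_nonpos (by positivity) h1
      (by have : 0 < 1 / p := by positivity
          linarith : -(1 / p) ≤ 0)
    rw [← Real.rpow_mul (hpos n).le, Real.mul_rpow (by positivity) hpε.le,
      ← Real.rpow_mul hε.le] at h2
    have e1 : -p * -(1 / p) = 1 := by field_simp
    have e2 : -(p / (p + 1)) * -(1 / p) = 1 / (p + 1) := by field_simp
    rwa [e1, e2, Real.rpow_one] at h2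
  nlinarith

/-- If the gaps of a positive null sequence satisfy `s n - s (n+1) ≤ s n ^ e`, the sequence is
`ε`-dense in an interval `(0, ε ^ (1/e) / 2)`. -/
lemma eventually_le_volume_thickening {s : ℕ → ℝ} {e : ℝ} (he : 1 < e) (hpos : ∀ n, 0 < s n)
    (hanti : Antitone s) (hlim : Tendsto s atTop (nhds 0))
    (hstep : ∀ᶠ n in atTop, s n - s (n + 1) ≤ s n ^ e) :
    ∀ᶠ ε in nhdsWithin 0 (Ioi 0),
      ENNReal.ofReal (ε ^ (1 / e) / 2) ≤ volume (thickening ε (range s)) := by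
  have hsmall : ∀ᶠ n in atTop, s n ^ (e - 1) < 1 / 2 := by
    have := hlim.rpow_const (p := e - 1) (Or.inr (by linarith))
    rw [Real.zero_rpow (by linarith)] at this
    exact this.eventually_lt_const (by norm_num)
  obtain ⟨M, hM⟩ := eventually_atTop.1 (hstep.and hsmall)
  have htend : Tendsto (fun ε : ℝ => ε ^ (1 / e) / 2) (nhdsWithin 0 (Ioi 0)) (nhds 0) := by
    have h0 : (0 : ℝ) < 1 / e := by positivity
    have := (Real.continuousAt_rpow_const 0 (1 / e) (Or.inr h0.le)).tendsto.div_const 2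
    rw [Real.zero_rpow h0.ne', zero_div] at this
    exact this.mono_left nhdsWithin_le_nhds
  filter_upwards [htend.eventually_lt_const (hpos M), self_mem_nhdsWithin] with ε hεM hε
  have hε : 0 < ε := hε
  have hsub : Ioo 0 (ε ^ (1 / e) / 2) ⊆ thickening ε (range s) := by
    rintro x ⟨hx0, hx⟩
    classical
    have hex : ∃ n, s n ≤ x := ((hlim.eventually_lt_const hx0).exists).imp fun _ h => h.le
    have hle := Nat.find_spec hex
    have hmin := fun m => Nat.find_min (m := m) hex
    have hMlt : M < Nat.find hex := by
      by_contra! h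
      linarith [hanti h]
    obtain ⟨m, hm⟩ : ∃ m, Nat.find hex = m + 1 := ⟨Nat.find hex - 1, by omega⟩
    rw [hm] at hle
    have hgt : x < s m := not_le.1 (hmin m (by omega))
    obtain ⟨hgap, hhalf⟩ := hM m (by omega)
    have hs := hpos m
    have hpow : s m ^ e = s m ^ (e - 1) * s m := by
      rw [Real.rpow_sub_one hs.ne']; field_simp
    have hdouble : s m ≤ 2 * x := by nlinarith
    have hlt : s m ^ e < ε := by
      calc s m ^ e < (ε ^ (1 / e)) ^ e :=
            Real.rpow_lt_rpow hs.le (by linarith) (by linarith)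
        _ = ε := by
            rw [← Real.rpow_mul hε.le, one_div_mul_cancel (by linarith), Real.rpow_one]
    refine mem_thickening_iff.2 ⟨_, mem_range_self (m + 1), ?_⟩
    rw [Real.dist_eq, abs_lt]
    constructor <;> linarith
  calc ENNReal.ofReal (ε ^ (1 / e) / 2) = volume (Ioo 0 (ε ^ (1 / e) / 2)) := by
        rw [Real.volume_Ioo, sub_zero]
    _ ≤ _ := measure_mono hsub

/-- If `|U_ε| ≤ K ε ^ q` near `0`, then `|U_ε| / ε ^ r` tends to `0` for `r < q`. -/
lemma limsup_volume_thickening_div_eq_zero {U : Set ℝ} {K q r : ℝ} (hqr : r < q)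
    (h : ∀ᶠ ε in nhdsWithin 0 (Ioi 0),
      volume (thickening ε U) ≤ ENNReal.ofReal (K * ε ^ q)) :
    limsup (fun ε : ℝ => volume (thickening ε U) / ENNReal.ofReal (ε ^ r))
      (nhdsWithin 0 (Ioi 0)) = 0 := by
  have htend : Tendsto (fun ε : ℝ => ENNReal.ofReal (K * ε ^ (q - r)))
      (nhdsWithin 0 (Ioi 0)) (nhds 0) := by
    have := (Real.continuousAt_rpow_const 0 (q - r) (Or.inr (by linarith))).tendsto.const_mul K
    rw [Real.zero_rpow (by linarith), mul_zero] at this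
    simpa using ENNReal.tendsto_ofReal (this.mono_left nhdsWithin_le_nhds)
  refine (tendsto_of_tendsto_of_tendsto_of_le_of_le' tendsto_const_nhds htend
    (Eventually.of_forall fun _ => zero_le) ?_).limsup_eq
  filter_upwards [h, self_mem_nhdsWithin] with ε hle hε
  have hε : 0 < ε := hε
  calc volume (thickening ε U) / ENNReal.ofReal (ε ^ r)
      ≤ ENNReal.ofReal (K * ε ^ q) / ENNReal.ofReal (ε ^ r) := by gcongr
    _ = ENNReal.ofReal (K * ε ^ (q - r)) := by
        rw [← ENNReal.ofReal_div_of_pos (Real.rpow_pos_of_pos hε _), Real.rpow_sub hε,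
          mul_div_assoc]

lemma liminf_volume_thickening_div_ne_zero {U : Set ℝ} {c q r : ℝ} (hc : 0 < c) (hqr : q ≤ r)
    (h : ∀ᶠ ε in nhdsWithin 0 (Ioi 0),
      ENNReal.ofReal (c * ε ^ q) ≤ volume (thickening ε U)) :
    liminf (fun ε : ℝ => volume (thickening ε U) / ENNReal.ofReal (ε ^ r))
      (nhdsWithin 0 (Ioi 0)) ≠ 0 := by
  refine ((ENNReal.ofReal_pos.2 hc).trans_le (le_liminf_of_le (by isBoundedDefault) ?_)).ne'
  filter_upwards [h, self_mem_nhdsWithin, Ioo_mem_nhdsGT (zero_lt_one' ℝ)] with ε hle hε hε1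
  have hε : 0 < ε := hε
  rw [ENNReal.le_div_iff_mul_le (Or.inl (by simpa using Real.rpow_pos_of_pos hε r))
    (Or.inl ENNReal.ofReal_ne_top), ← ENNReal.ofReal_mul hc.le]
  refine (ENNReal.ofReal_le_ofReal ?_).trans hle
  exact mul_le_mul_of_nonneg_left
    (Real.rpow_le_rpow_of_exponent_ge hε hε1.2.le hqr) hc.le

lemma hasBoxDim_of_liminf_of_limsup {U : Set ℝ} {N D : ℝ} (hD : 0 ≤ D)
    (hlow : ∀ d, 0 ≤ d → d < D → liminf
      (fun ε : ℝ => volume (thickening ε U) / ENNReal.ofReal (ε ^ (N - d)))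
      (nhdsWithin 0 (Ioi 0)) ≠ 0)
    (hup : ∀ d, D < d → limsup
      (fun ε : ℝ => volume (thickening ε U) / ENNReal.ofReal (ε ^ (N - d)))
      (nhdsWithin 0 (Ioi 0)) = 0) :
    HasBoxDim N U D := by
  have hlowup : ∀ d, limsup
      (fun ε : ℝ => volume (thickening ε U) / ENNReal.ofReal (ε ^ (N - d)))
      (nhdsWithin 0 (Ioi 0)) = 0 → liminf
      (fun ε : ℝ => volume (thickening ε U) / ENNReal.ofReal (ε ^ (N - d)))
      (nhdsWithin 0 (Ioi 0)) = 0 := fun d h => le_antisymm (h ▸ liminf_le_limsup) zero_le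
  constructor
  · refine csInf_eq_of_forall_ge_of_forall_gt_exists_lt
      ⟨D + 1, by linarith, hlowup _ (hup _ (by linarith))⟩
      (fun d hd => not_lt.1 fun h => hlow d hd.1 h hd.2) fun w hw => ?_
    obtain ⟨d, hd, hdw⟩ := exists_between hw
    exact ⟨d, ⟨by linarith, hlowup _ (hup _ hd)⟩, hdw⟩
  · refine csInf_eq_of_forall_ge_of_forall_gt_exists_lt
      ⟨D + 1, by linarith, hup _ (by linarith)⟩
      (fun d hd => not_lt.1 fun h => hlow d hd.1 h (hlowup _ hd.2)) fun w hw => ?_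
    obtain ⟨d, hd, hdw⟩ := exists_between hw
    exact ⟨d, ⟨by linarith, hup _ hd⟩, hdw⟩

/-- A positive decreasing null sequence whose gaps are `s n ^ (a + o(1))` has box dimension
`1 - 1/a`. -/
lemma hasBoxDim_range_of_gaps {s : ℕ → ℝ} {a : ℝ} (ha : 1 ≤ a) (hpos : ∀ n, 0 < s n)
    (hanti : Antitone s) (hlim : Tendsto s atTop (nhds 0))
    (hge : ∀ b, a < b → ∀ᶠ n in atTop, s n ^ b ≤ s n - s (n + 1))
    (hle : ∀ e, e < a → ∀ᶠ n in atTop, s n - s (n + 1) ≤ s n ^ e) :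
    HasBoxDim 1 (range s) (1 - 1 / a) := by
  have ha0 : 0 < a := by linarith
  have hcont : ContinuousAt (fun x : ℝ => 1 - 1 / x) a := by fun_prop (disch := exact ha0.ne')
  refine hasBoxDim_of_liminf_of_limsup (by rw [sub_nonneg, div_le_one ha0]; exact ha) ?_ ?_
  · intro d hd hda
    have ha1 : 1 < a := by
      by_contra! h
      rw [le_antisymm h ha] at hda
      linarith
    have hev : ∀ᶠ e in nhdsWithin a (Iio a), d < 1 - 1 / e ∧ 1 < e ∧ e < a :=
      (hcont.tendsto.mono_left nhdsWithin_le_nhds |>.eventually_const_lt hda).and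
        (Ioo_mem_nhdsLT ha1)
    obtain ⟨e, hde, he1, hea⟩ := hev.exists
    refine liminf_volume_thickening_div_ne_zero (c := 1 / 2) (q := 1 / e) (by norm_num)
      (by linarith) ?_
    filter_upwards [eventually_le_volume_thickening he1 hpos hanti hlim (hle e hea)] with ε h
    rwa [one_div_mul_eq_div]
  · intro d hda
    have hev : ∀ᶠ b in nhdsWithin a (Ioi a), 1 - 1 / b < d ∧ a < b :=
      (hcont.tendsto.mono_left nhdsWithin_le_nhds |>.eventually_lt_const hda).and
        self_mem_nhdsWithin
    obtain ⟨b, hdb, hab⟩ := hev.exists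
    obtain ⟨K, hK⟩ :=
      exists_volume_thickening_le (ha.trans_lt hab) hpos hanti (hge b hab)
    exact limsup_volume_thickening_div_eq_zero (by linarith) hK

/-- Orbits of `P` with `s - P s ∼ C s ^ m g(s)`, where `g` is bounded below by `1` and of
subpolynomial growth at `0⁺`, have box dimension `1 - 1/m`. -/
lemma hasBoxDim_orbit {P g : ℝ → ℝ} {δ C : ℝ} {m : ℕ} (hm : 1 ≤ m)
    (hmap : ∀ s ∈ Ioo (0 : ℝ) δ, P s ∈ Ioo (0 : ℝ) δ ∧ P s < s)
    (hC : 0 < C) (hg : ∀ᶠ s in nhdsWithin 0 (Ioi 0), 1 ≤ g s)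
    (hg' : ∀ r : ℝ, 0 < r → Tendsto (fun s => g s * s ^ r) (nhdsWithin 0 (Ioi 0)) (nhds 0))
    (hP : Tendsto (fun s => (s - P s) / (s ^ m * g s)) (nhdsWithin 0 (Ioi 0)) (nhds C))
    {s₀ : ℝ} (hs₀ : s₀ ∈ Ioo (0 : ℝ) δ)
    (horb : Tendsto (fun n : ℕ => P^[n] s₀) atTop (nhds 0)) :
    HasBoxDim 1 (range fun n : ℕ => P^[n] s₀) (1 - 1 / (m : ℝ)) := by
  have hmem : ∀ n : ℕ, P^[n] s₀ ∈ Ioo (0 : ℝ) δ := by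
    intro n
    induction n with
    | zero => exact hs₀
    | succ n ih => rw [Function.iterate_succ_apply']; exact (hmap _ ih).1
  have horb' : Tendsto (fun n : ℕ => P^[n] s₀) atTop (nhdsWithin 0 (Ioi 0)) :=
    tendsto_nhdsWithin_iff.2 ⟨horb, Eventually.of_forall fun n => (hmem n).1⟩
  refine hasBoxDim_range_of_gaps (by exact_mod_cast hm) (fun n => (hmem n).1)
    (antitone_nat_of_succ_le fun n => ?_) horb ?_ ?_
  · rw [Function.iterate_succ_apply']; exact (hmap _ (hmem n)).2.le
  · intro b hb
    simp only [Function.iterate_succ_apply']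
    refine horb'.eventually (p := fun s => s ^ b ≤ s - P s) ?_
    filter_upwards [self_mem_nhdsWithin, hg, hP.eventually_const_lt (half_lt_self hC),
      (hg' (b - m) (by linarith)).eventually_lt_const (half_pos hC)] with s hs hgs hlow hsmall
    have hs : 0 < s := hs
    have hsm : 0 < s ^ m := by positivity
    have hgs0 : 0 < g s := by linarith
    rw [lt_div_iff₀ (by positivity)] at hlow
    have hr : 0 < s ^ (b - m) := Real.rpow_pos_of_pos hs _
    have hpow : s ^ b = s ^ m * s ^ (b - m) := by
      rw [← Real.rpow_natCast, ← Real.rpow_add hs]; congr 1; ring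
    have h1 : s ^ (b - m) ≤ C / 2 * g s := by nlinarith
    calc s ^ b = s ^ m * s ^ (b - m) := hpow
      _ ≤ s ^ m * (C / 2 * g s) := by gcongr
      _ ≤ s - P s := by linarith
  · intro e he
    simp only [Function.iterate_succ_apply']
    refine horb'.eventually (p := fun s => s - P s ≤ s ^ e) ?_
    filter_upwards [self_mem_nhdsWithin, hg, hP.eventually_lt_const (lt_two_mul_self hC),
      (hg' (m - e) (by linarith)).eventually_lt_const (show 0 < 1 / (2 * C) by positivity)]
      with s hs hgs hupp hsmall
    have hs : 0 < s := hs
    have hsm : 0 < s ^ m := by positivity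
    have hgs0 : 0 < g s := by linarith
    rw [div_lt_iff₀ (by positivity)] at hupp
    rw [lt_div_iff₀ (by positivity)] at hsmall
    have hpow : s ^ m = s ^ e * s ^ (m - e) := by
      rw [← Real.rpow_natCast, ← Real.rpow_add hs]; congr 1; ring
    have hse : 0 < s ^ e := Real.rpow_pos_of_pos hs _
    calc s - P s ≤ 2 * C * (s ^ m * g s) := hupp.le
      _ = s ^ e * (g s * s ^ (m - e) * (2 * C)) := by rw [hpow]; ring
      _ ≤ s ^ e * 1 := by gcongr
      _ = s ^ e := mul_one _

lemma hasBoxDim_orbit_of_pow {P : ℝ → ℝ} {δ C : ℝ} {m : ℕ} (hm : 1 ≤ m)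
    (hmap : ∀ s ∈ Ioo (0 : ℝ) δ, P s ∈ Ioo (0 : ℝ) δ ∧ P s < s) (hC : 0 < C)
    (hP : Tendsto (fun s => (s - P s) / s ^ m) (nhdsWithin 0 (Ioi 0)) (nhds C))
    {s₀ : ℝ} (hs₀ : s₀ ∈ Ioo (0 : ℝ) δ)
    (horb : Tendsto (fun n : ℕ => P^[n] s₀) atTop (nhds 0)) :
    HasBoxDim 1 (range fun n : ℕ => P^[n] s₀) (1 - 1 / (m : ℝ)) := by
  refine hasBoxDim_orbit (g := fun _ => 1) hm hmap hC (Eventually.of_forall fun _ => le_rfl)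
    (fun r hr => ?_) (by simpa using hP) hs₀ horb
  have := (Real.continuousAt_rpow_const 0 r (Or.inr hr.le)).tendsto
  rw [Real.zero_rpow hr.ne'] at this
  simpa using this.mono_left nhdsWithin_le_nhds

lemma hasBoxDim_orbit_of_pow_mul_log {P : ℝ → ℝ} {δ C : ℝ} {m : ℕ} (hm : 1 ≤ m)
    (hmap : ∀ s ∈ Ioo (0 : ℝ) δ, P s ∈ Ioo (0 : ℝ) δ ∧ P s < s) (hC : 0 < C)
    (hP : Tendsto (fun s => (s - P s) / (s ^ m * (-Real.log s)))
      (nhdsWithin 0 (Ioi 0)) (nhds C))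
    {s₀ : ℝ} (hs₀ : s₀ ∈ Ioo (0 : ℝ) δ)
    (horb : Tendsto (fun n : ℕ => P^[n] s₀) atTop (nhds 0)) :
    HasBoxDim 1 (range fun n : ℕ => P^[n] s₀) (1 - 1 / (m : ℝ)) := by
  refine hasBoxDim_orbit (g := fun s => -Real.log s) hm hmap hC
    ((tendsto_neg_atBot_atTop.comp Real.tendsto_log_nhdsGT_zero).eventually_ge_atTop 1)
    (fun r hr => ?_) hP hs₀ horb
  simpa using (tendsto_log_mul_rpow_nhdsGT_zero hr).neg

/-- Box dimensions of orbits of Poincaré maps on a transversal away from the saddle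
vertex (`P`) and through the vertex (`P̂`), for a saddle loop of codimension `k ≥ 2`.
If `k` is even, `s − P(s) ∼ C s^{k/2}` and `s − P̂(s) ∼ Ĉ s^{k−1}`; if `k` is odd,
`s − P(s) ∼ C s^{(k+1)/2}(−log s)` and `s − P̂(s) ∼ Ĉ s^k(−log s)` (with `Ĉ < 1`
when `k = 2`).  Then every orbit of `P` has box dimension `1 − 2/k` (`k` even) or
`1 − 2/(k+1)` (`k` odd), and every orbit of `P̂` has box dimension `1 − 1/(k−1)`
(`k` even) or `1 − 1/k` (`k` odd). -/
theorem boxDim_orbits_two_transversals (k : ℕ) (hk : 2 ≤ k) (δ : ℝ) (hδ : 0 < δ)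
    (P Phat : ℝ → ℝ)
    (hPmap : ∀ s ∈ Set.Ioo (0:ℝ) δ, P s ∈ Set.Ioo (0:ℝ) δ ∧ P s < s)
    (hPhatmap : ∀ s ∈ Set.Ioo (0:ℝ) δ, Phat s ∈ Set.Ioo (0:ℝ) δ ∧ Phat s < s)
    (hPorb : ∀ s₀ ∈ Set.Ioo (0:ℝ) δ,
      Tendsto (fun n : ℕ => P^[n] s₀) atTop (nhds 0))
    (hPhatorb : ∀ s₀ ∈ Set.Ioo (0:ℝ) δ,
      Tendsto (fun n : ℕ => Phat^[n] s₀) atTop (nhds 0))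
    (heven : Even k →
      (∃ C : ℝ, 0 < C ∧ Tendsto (fun s : ℝ => (s - P s) / s ^ (k / 2))
        (nhdsWithin 0 (Set.Ioi 0)) (nhds C)) ∧
      (∃ Chat : ℝ, 0 < Chat ∧ (k = 2 → Chat < 1) ∧
        Tendsto (fun s : ℝ => (s - Phat s) / s ^ (k - 1))
          (nhdsWithin 0 (Set.Ioi 0)) (nhds Chat)))
    (hodd : ¬ Even k →
      (∃ C : ℝ, 0 < C ∧
        Tendsto (fun s : ℝ => (s - P s) / (s ^ ((k + 1) / 2) * (-Real.log s)))
          (nhdsWithin 0 (Set.Ioi 0)) (nhds C)) ∧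
      (∃ Chat : ℝ, 0 < Chat ∧
        Tendsto (fun s : ℝ => (s - Phat s) / (s ^ k * (-Real.log s)))
          (nhdsWithin 0 (Set.Ioi 0)) (nhds Chat))) :
    ∀ s₀ ∈ Set.Ioo (0:ℝ) δ,
      HasBoxDim 1 (Set.range fun n : ℕ => P^[n] s₀)
        (if Even k then 1 - 2 / (k : ℝ) else 1 - 2 / ((k : ℝ) + 1)) ∧
      HasBoxDim 1 (Set.range fun n : ℕ => Phat^[n] s₀)
        (if Even k then 1 - 1 / ((k : ℝ) - 1) else 1 - 1 / (k : ℝ)) := by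
  intro s₀ hs₀
  by_cases hev : Even k
  · obtain ⟨⟨C, hC, hP⟩, Chat, hChat, -, hPhat⟩ := heven hev
    simp only [if_pos hev]
    obtain ⟨j, rfl⟩ := hev.two_dvd
    constructor
    · have h := hasBoxDim_orbit_of_pow (by omega) hPmap hC hP hs₀ (hPorb s₀ hs₀)
      rw [Nat.mul_div_cancel_left j two_pos] at h
      convert h using 2
      have : (j : ℝ) ≠ 0 := by exact_mod_cast (by omega : j ≠ 0)
      push_cast
      field_simp
    · have h := hasBoxDim_orbit_of_pow (by omega) hPhatmap hChat hPhat hs₀ (hPhatorb s₀ hs₀)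
      rwa [Nat.cast_sub (by omega), Nat.cast_one] at h
  · obtain ⟨⟨C, hC, hP⟩, Chat, hChat, hPhat⟩ := hodd hev
    simp only [if_neg hev]
    constructor
    · have h := hasBoxDim_orbit_of_pow_mul_log (by omega) hPmap hC hP hs₀ (hPorb s₀ hs₀)
      obtain ⟨j, rfl⟩ := Nat.not_even_iff_odd.1 hev
      rw [show (2 * j + 1 + 1) / 2 = j + 1 by omega] at h
      convert h using 2
      have : (j : ℝ) + 1 ≠ 0 := by positivity
      push_cast
      rw [show (2 * j + 1 + 1 : ℝ) = 2 * (j + 1) by ring]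
      field_simp
    · exact hasBoxDim_orbit_of_pow_mul_log (by omega) hPhatmap hChat hPhat hs₀ (hPhatorb s₀ hs₀)
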